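/- Let X be a separable real Banach space, let f : X → ℝ be quasiconvex and densely continuous, and let m ∈ ℝ be the topological essential infimum of f. Then there exists an Aronszajn null set N ⊆ X such that f is Hadamard differentiable at every point of (X \ F'_m) \ N, where F'_m = {x ∈ X : f(x) ≤ m}. -/

import Mathlib

open Filter Topology Set MeasureTheory

/-- `f` is quasiconvex: `f (l•x + (1-l)•y) ≤ max (f x) (f y)` for `l ∈ [0,1]`. -/
def QuasiconvexFun {X : Type*} [AddCommGroup X] [Module ℝ X] (f : X → ℝ) : Prop :=
  ∀ x y : X, ∀ l : ℝ, l ∈ Set.Icc (0 : ℝ) 1 →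
    f (l • x + (1 - l) • y) ≤ max (f x) (f y)

/-- `f` is strictly quasiconvex. -/
def StrictlyQuasiconvexFun {X : Type*} [AddCommGroup X] [Module ℝ X] (f : X → ℝ) : Prop :=
  ∀ x y : X, x ≠ y → ∀ l : ℝ, l ∈ Set.Ioo (0 : ℝ) 1 →
    f (l • x + (1 - l) • y) < max (f x) (f y)

/-- `f` is densely continuous: its set of points of continuity is dense. -/
def DenselyContinuous {X : Type*} [TopologicalSpace X] (f : X → ℝ) : Prop :=
  Dense {x : X | ContinuousAt f x}

/-- `m` is the topological essential infimum of `f`: the strict sublevel set `{f < α}`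
is meager for `α < m` and nonmeager for `α > m`. -/
def IsTopEssInf {X : Type*} [TopologicalSpace X] (f : X → ℝ) (m : ℝ) : Prop :=
  (∀ α : ℝ, α < m → IsMeagre {x : X | f x < α}) ∧
  (∀ α : ℝ, m < α → ¬ IsMeagre {x : X | f x < α})

/-- Aronszajn null set: a Borel set `N` such that for every sequence `ξ` with dense linear
span, `N` decomposes as a countable union of Borel sets, the `n`-th of which has Lebesgue
null intersection with every line of direction `ξ n`. -/
def AronszajnNull {X : Type*} [NormedAddCommGroup X] [NormedSpace ℝ X]
    [MeasurableSpace X] (N : Set X) : Prop :=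
  MeasurableSet N ∧
  ∀ ξ : ℕ → X, Dense (Submodule.span ℝ (Set.range ξ) : Set X) →
    ∃ Nn : ℕ → Set X, N = ⋃ n, Nn n ∧
      ∀ n, MeasurableSet (Nn n) ∧
        ∀ x : X, MeasureTheory.volume {t : ℝ | x + t • ξ n ∈ Nn n} = 0

/-- Haar null set: `E` is contained in a Borel set `B` for which there is a Borel
probability measure vanishing on all translates of `B`. -/
def HaarNull {X : Type*} [AddCommGroup X] [TopologicalSpace X]
    [MeasurableSpace X] (E : Set X) : Prop :=
  ∃ B : Set X, E ⊆ B ∧ MeasurableSet B ∧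
    ∃ μ : MeasureTheory.Measure X, MeasureTheory.IsProbabilityMeasure μ ∧
      ∀ x : X, μ ((fun y => x + y) '' B) = 0

/-- Hadamard differentiability of `f` at `x`. -/
def HadamardDiffAt {X : Type*} [NormedAddCommGroup X] [NormedSpace ℝ X]
    (f : X → ℝ) (x : X) : Prop :=
  ∃ L : X →L[ℝ] ℝ, ∀ h : X, ∀ t : ℕ → ℝ, (∀ n, t n ≠ 0) →
    Tendsto t atTop (𝓝 0) → ∀ hs : ℕ → X, Tendsto hs atTop (𝓝 h) →
      Tendsto (fun n => (f (x + t n • hs n) - f x) / t n) atTop (𝓝 (L h))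

/-- Hadamard differentiability at `x` of a function whose relevant values are those on `V`. -/
def HadamardDiffWithinAt {X : Type*} [NormedAddCommGroup X] [NormedSpace ℝ X]
    (f : X → ℝ) (V : Set X) (x : X) : Prop :=
  ∃ L : X →L[ℝ] ℝ, ∀ h : X, ∀ t : ℕ → ℝ, (∀ n, t n ≠ 0) →
    Tendsto t atTop (𝓝 0) → ∀ hs : ℕ → X, Tendsto hs atTop (𝓝 h) →
      (∀ n, x + t n • hs n ∈ V) →
      Tendsto (fun n => (f (x + t n • hs n) - f x) / t n) atTop (𝓝 (L h))

/-- Gâteaux differentiability of `f` at `x` with derivative `L`. -/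
def GateauxDiffAt {X : Type*} [NormedAddCommGroup X] [NormedSpace ℝ X]
    (f : X → ℝ) (x : X) (L : X →L[ℝ] ℝ) : Prop :=
  ∀ h : X, Tendsto (fun t : ℝ => (f (x + t • h) - f x) / t) (𝓝[≠] 0) (𝓝 (L h))

/-- Essential Gâteaux differentiability of `f` at `x`: directional derivatives exist and
are given by a continuous linear functional for a comeager (residual) set of directions
in the unit sphere. -/
def EssGateauxDiffAt {X : Type*} [NormedAddCommGroup X] [NormedSpace ℝ X]
    (f : X → ℝ) (x : X) : Prop :=
  ∃ L : X →L[ℝ] ℝ, ∃ Ω : Set (Metric.sphere (0 : X) 1), IsMeagre Ωᶜ ∧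
    ∀ h ∈ Ω, Tendsto (fun t : ℝ => (f (x + t • (h : X)) - f x) / t) (𝓝[≠] 0) (𝓝 (L (h : X)))

/-- `K` is a closed convex cone. -/
def IsClosedConvexCone {X : Type*} [NormedAddCommGroup X] [NormedSpace ℝ X] (K : Set X) : Prop :=
  IsClosed K ∧ Convex ℝ K ∧ ∀ l : ℝ, 0 ≤ l → ∀ k ∈ K, l • k ∈ K

/-- `f` is `K`-nondecreasing on `U`. -/
def KNondecreasingOn {X : Type*} [AddCommGroup X] [Module ℝ X]
    (f : X → ℝ) (K U : Set X) : Prop :=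
  ∀ u ∈ U, ∀ k ∈ K, k ≠ 0 → u + k ∈ U → f u ≤ f (u + k)

/-- Ideally convex subset: stable under infinite convex combinations of bounded sequences. -/
def IdeallyConvex {X : Type*} [NormedAddCommGroup X] [NormedSpace ℝ X] (C : Set X) : Prop :=
  ∀ (x : ℕ → X) (lam : ℕ → ℝ), (∀ n, x n ∈ C) → Bornology.IsBounded (Set.range x) →
    (∀ n, lam n ∈ Set.Icc (0 : ℝ) 1) → HasSum lam 1 →
      ∑' n, lam n • x n ∈ C

/-- `C‡`: the union, over finite dimensional subspaces `Z ⊆ X`, of the closures of `C ∩ Z`. -/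
def Ddag {X : Type*} [NormedAddCommGroup X] [NormedSpace ℝ X] (C : Set X) : Set X :=
  ⋃ (Z : Submodule ℝ X) (_ : FiniteDimensional ℝ Z), closure (C ∩ (Z : Set X))

/-- A normed space is reflexive if the canonical inclusion into its double dual is onto. -/
def IsReflexiveSpace (X : Type*) [NormedAddCommGroup X] [NormedSpace ℝ X] : Prop :=
  Function.Surjective (NormedSpace.inclusionInDoubleDual ℝ X)


noncomputable section HadAux

/-- linear combination map -/
def cmb {X : Type*} [NormedAddCommGroup X] [NormedSpace ℝ X] {n : ℕ} (ξ : Fin n → X) :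
    (Fin n → ℝ) →L[ℝ] X :=
  LinearMap.toContinuousLinearMap (Fintype.linearCombination ℝ ξ)

lemma cmb_apply {X : Type*} [NormedAddCommGroup X] [NormedSpace ℝ X] {n : ℕ} (ξ : Fin n → X)
    (v : Fin n → ℝ) : cmb ξ v = ∑ i, v i • ξ i := by
  simp [cmb, Fintype.linearCombination_apply]

/-- decomposability along a given sequence -/
def ADec {X : Type*} [NormedAddCommGroup X] [NormedSpace ℝ X] [MeasurableSpace X]
    (ξ : ℕ → X) (N : Set X) : Prop :=
  ∃ Nn : ℕ → Set X, N = ⋃ n, Nn n ∧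
      ∀ n, MeasurableSet (Nn n) ∧
        ∀ x : X, MeasureTheory.volume {t : ℝ | x + t • ξ n ∈ Nn n} = 0

lemma ADec.iUnion {X : Type*} [NormedAddCommGroup X] [NormedSpace ℝ X] [MeasurableSpace X]
    {ι : Type*} [Countable ι] {ξ : ℕ → X} {S : ι → Set X} (h : ∀ i, ADec ξ (S i)) :
    ADec ξ (⋃ i, S i) := by
  choose Nn h1 h2 using h
  refine ⟨fun n => ⋃ i, Nn i n, ?_, fun n => ⟨MeasurableSet.iUnion fun i => (h2 i n).1, ?_⟩⟩
  · rw [iUnion_comm]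
    exact iUnion_congr h1
  · intro x
    have : {t : ℝ | x + t • ξ n ∈ ⋃ i, Nn i n} = ⋃ i, {t : ℝ | x + t • ξ n ∈ Nn i n} := by
      ext t; simp
    rw [this]
    exact measure_iUnion_null fun i => (h2 i n).2 x

lemma AronszajnNull.iUnion' {X : Type*} [NormedAddCommGroup X] [NormedSpace ℝ X]
    [MeasurableSpace X] {ι : Type*} [Countable ι] {S : ι → Set X}
    (h : ∀ i, AronszajnNull (S i)) : AronszajnNull (⋃ i, S i) :=
  ⟨MeasurableSet.iUnion fun i => (h i).1, fun ξ hξ => ADec.iUnion fun i => (h i).2 ξ hξ⟩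

lemma AronszajnNull.union' {X : Type*} [NormedAddCommGroup X] [NormedSpace ℝ X]
    [MeasurableSpace X] {S T : Set X}
    (h : AronszajnNull S) (h' : AronszajnNull T) : AronszajnNull (S ∪ T) := by
  rw [union_eq_iUnion]
  exact AronszajnNull.iUnion' fun b => by cases b <;> assumption

lemma decomp_fin {X : Type*} [NormedAddCommGroup X] [NormedSpace ℝ X]
    [SecondCountableTopology X] [MeasurableSpace X] [BorelSpace X] :
    ∀ (n : ℕ) (ξ : Fin n → X) (A : Set X), MeasurableSet A →
      (∀ x, volume {v : Fin n → ℝ | x + cmb ξ v ∈ A} = 0) →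
      ∃ Nn : Fin n → Set X, A = ⋃ i, Nn i ∧ ∀ i, MeasurableSet (Nn i) ∧
        ∀ x : X, volume {t : ℝ | x + t • ξ i ∈ Nn i} = 0 := by
  intro n
  induction n with
  | zero =>
    intro ξ A hA h
    refine ⟨fun _ => ∅, ?_, fun i => i.elim0⟩
    ext x
    simp only [mem_iUnion, mem_empty_iff_false, exists_false, iff_false]
    intro hx
    have := h x
    have h2 : {v : Fin 0 → ℝ | x + cmb ξ v ∈ A} = univ := by
      ext v; simp [cmb_apply, hx]
    rw [h2, volume_pi, Measure.pi_of_empty (x := fun i => i.elim0)] at this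
    simp at this
  | succ n ih =>
    intro ξ A hA h
    have hmeas : Measurable fun x : X => volume {s : ℝ | x + s • ξ 0 ∈ A} := by
      have hc : Continuous fun p : X × ℝ => p.1 + p.2 • ξ 0 := by fun_prop
      exact measurable_measure_prodMk_left (hc.measurable hA)
    set A0 : Set X := A ∩ {x | volume {s : ℝ | x + s • ξ 0 ∈ A} = 0} with hA0
    have mA0 : MeasurableSet A0 := hA.inter (hmeas (measurableSet_singleton 0))
    have nA0 : ∀ x : X, volume {t : ℝ | x + t • ξ 0 ∈ A0} = 0 := by
      intro x
      by_cases hx : ∃ t0 : ℝ, x + t0 • ξ 0 ∈ A0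
      · obtain ⟨t0, ht0⟩ := hx
        have h1 := ht0.2
        simp only [mem_ofPred_eq] at h1
        rw [← measure_preimage_add_right volume (-t0)] at h1
        refine measure_mono_null ?_ h1
        intro t ht
        simp only [mem_preimage, mem_ofPred_eq]
        have : x + t0 • ξ 0 + (t + -t0) • ξ 0 = x + t • ξ 0 := by module
        rw [this]; exact ht.1
      · push Not at hx
        have : {t : ℝ | x + t • ξ 0 ∈ A0} = ∅ := by
          ext t; simpa using hx t
        rw [this]; simp
    have hR : ∀ x, volume {v : Fin n → ℝ | x + cmb (fun i => ξ i.succ) v ∈ A \ A0} = 0 := by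
      intro x
      have h1 := h x
      have mp := (volume_preserving_piFinSuccAbove (fun _ : Fin (n+1) => ℝ) 0).symm
      have mS : MeasurableSet {v : Fin (n+1) → ℝ | x + cmb ξ v ∈ A} := by
        have hc : Continuous fun v : Fin (n+1) → ℝ => x + cmb ξ v := by fun_prop
        exact hc.measurable hA
      rw [← mp.measure_preimage mS.nullMeasurableSet] at h1
      rw [Measure.volume_eq_prod, ← (Measure.measurePreserving_swap (μ := (volume : Measure (Fin n → ℝ)))
        (ν := (volume : Measure ℝ))).measure_preimage] at h1
      · have h2 := Measure.measure_ae_null_of_prod_null h1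
        refine measure_mono_null ?_ h2
        intro v hv
        simp only [mem_compl_iff, mem_ofPred_eq]
        intro h0
        apply hv.2
        refine ⟨hv.1, ?_⟩
        simp only [Pi.zero_apply] at h0
        refine measure_mono_null ?_ h0
        intro t ht
        have e : x + cmb (fun i => ξ i.succ) v + t • ξ 0 = x + (t • ξ 0 + cmb (fun i => ξ i.succ) v) := by abel
        simp only [mem_ofPred_eq] at ht
        rw [e] at ht
        simp only [mem_preimage, mem_ofPred_eq, Prod.swap_prod_mk]
        convert! ht using 2
        rw [cmb_apply, cmb_apply, Fin.sum_univ_succ]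
        simp [MeasurableEquiv.piFinSuccAbove]
      · exact (mp.measurable mS).nullMeasurableSet
    obtain ⟨M, hM1, hM2⟩ := ih (fun i => ξ i.succ) (A \ A0) (hA.diff mA0) hR
    refine ⟨Fin.cons A0 M, ?_, ?_⟩
    · ext x
      simp only [mem_iUnion, Fin.exists_fin_succ, Fin.cons_zero, Fin.cons_succ]
      rw [← mem_iUnion, ← hM1]
      by_cases hx : x ∈ A0
      · simp [hx, hx.1]
      · simp [hx]
    · intro i
      refine Fin.cases ⟨mA0, nA0⟩ (fun j => hM2 j) i

lemma decomp_nat {X : Type*} [NormedAddCommGroup X] [NormedSpace ℝ X]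
    [SecondCountableTopology X] [MeasurableSpace X] [BorelSpace X]
    (ξ : ℕ → X) (n : ℕ) (A : Set X) (hA : MeasurableSet A)
    (h : ∀ x, volume {v : Fin n → ℝ | x + cmb (fun i : Fin n => ξ i) v ∈ A} = 0) :
    ADec ξ A := by
  obtain ⟨M, h1, h2⟩ := decomp_fin n (fun i : Fin n => ξ i) A hA h
  refine ⟨fun k => if hk : k < n then M ⟨k, hk⟩ else ∅, ?_, ?_⟩
  · rw [h1]
    ext x
    simp only [mem_iUnion]
    constructor
    · rintro ⟨i, hi⟩
      exact ⟨i, by simpa using hi⟩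
    · rintro ⟨k, hk⟩
      split_ifs at hk with hkn
      · exact ⟨_, hk⟩
      · exact hk.elim
  · intro k
    by_cases hk : k < n
    · simpa [hk] using h2 ⟨k, hk⟩
    · simp [hk]

lemma mem_span_cmb {X : Type*} [NormedAddCommGroup X] [NormedSpace ℝ X] (ξ : ℕ → X) {e : X}
    (he : e ∈ Submodule.span ℝ (range ξ)) :
    ∃ n0, ∀ n ≥ n0, ∃ c : Fin n → ℝ, cmb (fun i : Fin n => ξ i) c = e := by
  obtain ⟨c, rfl⟩ := Finsupp.mem_span_range_iff_exists_finsupp.1 he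
  refine ⟨c.support.sup id + 1, fun n hn => ⟨fun i => c i, ?_⟩⟩
  rw [cmb_apply, Fin.sum_univ_eq_sum_range (fun i => c i • ξ i) n, Finsupp.sum]
  symm
  apply Finset.sum_subset
  · intro i hi
    have : i ≤ c.support.sup id := Finset.le_sup (f := id) hi
    simp; omega
  · intro i _ hi
    simp [Finsupp.notMem_support_iff.1 hi]

/-- local nullity in an open set of directions implies Aronszajn nullity -/
lemma aronszajn_of_local {X : Type*} [NormedAddCommGroup X] [NormedSpace ℝ X]
    [SecondCountableTopology X] [MeasurableSpace X] [BorelSpace X]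
    (P : Set X) (hP : MeasurableSet P)
    (h : ∀ x0 ∈ P, ∃ U, IsOpen U ∧ x0 ∈ U ∧ ∃ V : Set X, IsOpen V ∧ V.Nonempty ∧
      ∀ e ∈ V, ∀ y, volume {t : ℝ | y + t • e ∈ P ∩ U} = 0) : AronszajnNull P := by
  choose! U hU hxU V hV hVn hnull using h
  obtain ⟨T, hTP, hTc, hcov⟩ := TopologicalSpace.countable_cover_nhdsWithin
    (f := U) (s := P) (fun x hx => mem_nhdsWithin_of_mem_nhds ((hU x hx).mem_nhds (hxU x hx)))
  have : P = ⋃ x : T, P ∩ U x := by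
    rw [← inter_iUnion]
    symm
    rw [inter_eq_left]
    simpa using hcov
  rw [this]
  have := hTc.to_subtype
  refine AronszajnNull.iUnion' ?_
  rintro ⟨x, hx⟩
  have hxP := hTP hx
  have mPU : MeasurableSet (P ∩ U x) := hP.inter (hU x hxP).measurableSet
  refine ⟨mPU, fun ξ hξ => ?_⟩
  obtain ⟨e, heV, heS⟩ := hξ.inter_open_nonempty _ (hV x hxP) (hVn x hxP)
  obtain ⟨n, hn⟩ := mem_span_cmb ξ heS
  obtain ⟨c, hc⟩ := hn n le_rfl
  refine decomp_nat ξ n _ mPU fun y => ?_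
  have hcont : Continuous fun v : Fin n → ℝ => y + cmb (fun i : Fin n => ξ i) v := by fun_prop
  have mS : MeasurableSet {v : Fin n → ℝ | y + cmb (fun i : Fin n => ξ i) v ∈ P ∩ U x} :=
    hcont.measurable mPU
  have := ae_mem_of_ae_add_linearMap_mem (LinearMap.toSpanSingleton ℝ (Fin n → ℝ) c)
    volume volume mS.compl (fun z => by
      have := hnull x hxP e heV (y + cmb (fun i : Fin n => ξ i) z)
      rw [ae_iff]
      convert this using 3
      ext t
      simp [LinearMap.toSpanSingleton_apply, map_add, hc, add_assoc])
  rw [ae_iff] at this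
  convert this using 2
  ext v
  simp

/-- differentiability on the first `n` directions -/
def GDn {X : Type*} [NormedAddCommGroup X] [NormedSpace ℝ X] (g : X → ℝ) (ξ : ℕ → X) (n : ℕ)
    (x : X) : Prop :=
  DifferentiableAt ℝ (fun v : Fin n → ℝ => g (x + cmb (fun i : Fin n => ξ i) v)) 0

lemma hadamard_of_GDn {X : Type*} [NormedAddCommGroup X] [NormedSpace ℝ X] {g : X → ℝ}
    {C : NNReal} (hg : LipschitzWith C g) {ξ : ℕ → X}
    (hξ : Dense (Submodule.span ℝ (Set.range ξ) : Set X)) {x : X} (hx : ∀ n, GDn g ξ n x) :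
    HadamardDiffAt g x := by
  set S := Submodule.span ℝ (Set.range ξ) with hS
  have key : ∀ (n : ℕ) (c : Fin n → ℝ), HasLineDerivAt ℝ g
      (fderiv ℝ (fun v : Fin n → ℝ => g (x + cmb (fun i : Fin n => ξ i) v)) 0 c) x
      (cmb (fun i : Fin n => ξ i) c) := by
    intro n c
    have h := (hx n).hasFDerivAt.hasLineDerivAt c
    unfold HasLineDerivAt at h ⊢
    simpa using h
  have hadd : ∀ u ∈ S, ∀ v ∈ S, lineDeriv ℝ g x (u + v) = lineDeriv ℝ g x u + lineDeriv ℝ g x v := by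
    intro u hu v hv
    obtain ⟨n1, h1⟩ := mem_span_cmb ξ hu
    obtain ⟨n2, h2⟩ := mem_span_cmb ξ hv
    obtain ⟨a, rfl⟩ := h1 (max n1 n2) (le_max_left _ _)
    obtain ⟨b, rfl⟩ := h2 (max n1 n2) (le_max_right _ _)
    rw [← map_add, (key _ a).lineDeriv, (key _ b).lineDeriv, (key _ (a + b)).lineDeriv, map_add]
  have hdiff : ∀ u ∈ S, HasLineDerivAt ℝ g (lineDeriv ℝ g x u) x u := by
    intro u hu
    obtain ⟨n1, h1⟩ := mem_span_cmb ξ hu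
    obtain ⟨a, rfl⟩ := h1 _ le_rfl
    rw [(key _ a).lineDeriv]
    exact key _ a
  let L0 : S →ₗ[ℝ] ℝ :=
    { toFun := fun u => lineDeriv ℝ g x u
      map_add' := fun u v => by simpa using hadd u u.2 v v.2
      map_smul' := fun c u => by simp [lineDeriv_smul] }
  let L1 : S →L[ℝ] ℝ := L0.mkContinuous C (fun u => by
    simpa [L0] using norm_lineDeriv_le_of_lipschitz ℝ (v := (u : X)) (x₀ := x) hg)
  obtain ⟨L, hL, -⟩ := exists_extension_norm_eq S L1
  have hL' : ∀ u ∈ S, HasLineDerivAt ℝ g (L u) x u := by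
    intro u hu
    have := hL ⟨u, hu⟩
    simp only at this
    rw [this]
    exact hdiff u hu
  refine ⟨L, fun h t ht0 ht hs hh => ?_⟩
  rw [Metric.tendsto_atTop']
  intro ε hε
  set M : ℝ := C + C + ‖L‖ + 1 with hM
  have hMpos : 0 < M := by positivity
  set δ := ε / (2 * M) with hδ
  have hδpos : 0 < δ := by positivity
  obtain ⟨u, hu, huS⟩ := Metric.dense_iff.1 hξ h δ hδpos
  rw [mem_ball_iff_norm] at hu
  have h1 : Tendsto (fun n => (t n)⁻¹ • (g (x + t n • u) - g x)) atTop (𝓝 (L u)) :=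
    (hasLineDerivAt_iff_tendsto_slope_zero.1 (hL' u huS)).comp
      (tendsto_nhdsWithin_iff.2 ⟨ht, Eventually.of_forall ht0⟩)
  have e1 := (Metric.tendsto_nhds.1 h1 (ε / 2) (by positivity))
  have e2 := (Metric.tendsto_nhds.1 hh δ hδpos)
  obtain ⟨n0, hn0⟩ := eventually_atTop.1 (e1.and e2)
  refine ⟨n0, fun n hn => ?_⟩
  obtain ⟨a1, a2⟩ := hn0 n hn.le
  rw [Real.dist_eq] at a1 ⊢
  rw [dist_eq_norm] at a2
  have htn := ht0 n
  have b1 : |(g (x + t n • hs n) - g x) / t n - (t n)⁻¹ • (g (x + t n • u) - g x)| ≤ C * ‖hs n - u‖ := by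
    have : (g (x + t n • hs n) - g x) / t n - (t n)⁻¹ • (g (x + t n • u) - g x)
      = (g (x + t n • hs n) - g (x + t n • u)) / t n := by
      simp only [smul_eq_mul]; field_simp; ring
    rw [this, abs_div, div_le_iff₀ (abs_pos.2 htn)]
    have := hg.dist_le_mul (x + t n • hs n) (x + t n • u)
    rw [Real.dist_eq, dist_eq_norm] at this
    have e : x + t n • hs n - (x + t n • u) = t n • (hs n - u) := by module
    rw [e, norm_smul, Real.norm_eq_abs] at this
    linarith
  have b2 : |L u - L h| ≤ ‖L‖ * ‖u - h‖ := by
    rw [← map_sub]; exact L.le_opNorm _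
  have b3 : ‖hs n - u‖ ≤ δ + δ := by
    have : hs n - u = (hs n - h) - (u - h) := by abel
    rw [this]
    exact (norm_sub_le _ _).trans (by linarith)
  have hLn := norm_nonneg L
  have b4 : (C : ℝ) * ‖hs n - u‖ ≤ C * (δ + δ) := by gcongr
  have b5 : ‖L‖ * ‖u - h‖ ≤ ‖L‖ * δ := by gcongr
  have b6 : M * δ = ε / 2 := by rw [hδ]; field_simp
  have b7 : M * δ = C * (δ + δ) + ‖L‖ * δ + δ := by rw [hM]; ring
  rw [abs_le] at b1 b2
  rw [abs_lt] at a1 ⊢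
  constructor <;> linarith [b1.1, b1.2, b2.1, b2.2, a1.1, a1.2]

lemma GDn_of_hadamard {X : Type*} [NormedAddCommGroup X] [NormedSpace ℝ X] {g : X → ℝ}
    {C : NNReal} (hg : LipschitzWith C g) (ξ : ℕ → X) {x : X} (hx : HadamardDiffAt g x) (n : ℕ) :
    GDn g ξ n x := by
  obtain ⟨L, hL⟩ := hx
  have hlip : LipschitzWith (C * ‖cmb (fun i : Fin n => ξ i)‖₊)
      (fun v : Fin n → ℝ => g (x + cmb (fun i : Fin n => ξ i) v)) := by
    refine hg.comp ?_
    simpa using (LipschitzWith.const x).add (cmb (fun i : Fin n => ξ i)).lipschitz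
  refine (hlip.hasFDerivAt_of_hasLineDerivAt_of_closure (s := univ) (by simp)
    (L := L.comp (cmb (fun i : Fin n => ξ i))) fun v _ => ?_).differentiableAt
  rw [hasLineDerivAt_iff_tendsto_slope_zero]
  refine tendsto_of_seq_tendsto fun t ht => ?_
  rw [tendsto_nhdsWithin_iff] at ht
  obtain ⟨n0, hn0⟩ := eventually_atTop.1 ht.2
  rw [← tendsto_add_atTop_iff_nat n0]
  have := hL (cmb (fun i : Fin n => ξ i) v) (fun k => t (k + n0))
    (fun k => hn0 _ (by omega)) (ht.1.comp (tendsto_add_atTop_nat n0)) (fun _ => _) tendsto_const_nhds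
  simpa [div_eq_inv_mul] using this

lemma lipschitz_aronszajn {X : Type*} [NormedAddCommGroup X] [NormedSpace ℝ X]
    [SecondCountableTopology X] [MeasurableSpace X] [BorelSpace X] {g : X → ℝ}
    {C : NNReal} (hg : LipschitzWith C g) :
    ∃ N : Set X, AronszajnNull N ∧ ∀ x ∉ N, HadamardDiffAt g x := by
  have meas : ∀ (ξ : ℕ → X) (n : ℕ), MeasurableSet {x | ¬ GDn g ξ n x} := by
    intro ξ n
    have hc : Continuous (Function.uncurry
        fun (x : X) (v : Fin n → ℝ) => g (x + cmb (fun i : Fin n => ξ i) v)) := by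
      have := hg.continuous
      simp only [Function.uncurry_def]
      fun_prop
    have h1 := measurableSet_of_differentiableAt_with_param ℝ hc
    have h2 : Measurable fun x : X => (x, (0 : Fin n → ℝ)) := by fun_prop
    exact (h2 h1).compl
  let ζ := TopologicalSpace.denseSeq X
  have hζ : Dense (Submodule.span ℝ (Set.range ζ) : Set X) :=
    (TopologicalSpace.denseRange_denseSeq X).mono Submodule.subset_span
  refine ⟨{x | ¬ HadamardDiffAt g x}, ⟨?_, fun ξ hξ => ?_⟩, fun x hx => not_not.1 hx⟩
  · have : {x | ¬ HadamardDiffAt g x} = ⋃ n, {x | ¬ GDn g ζ n x} := by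
      ext x
      simp only [mem_ofPred_eq, mem_iUnion]
      rw [← not_forall, not_iff_not]
      exact ⟨fun h n => GDn_of_hadamard hg ζ h n, hadamard_of_GDn hg hζ⟩
    rw [this]
    exact MeasurableSet.iUnion (meas ζ)
  · have : {x | ¬ HadamardDiffAt g x} = ⋃ n, {x | ¬ GDn g ξ n x} := by
      ext x
      simp only [mem_ofPred_eq, mem_iUnion]
      rw [← not_forall, not_iff_not]
      exact ⟨fun h n => GDn_of_hadamard hg ξ h n, hadamard_of_GDn hg hξ⟩
    rw [this]
    refine ADec.iUnion fun n => decomp_nat ξ n _ (meas ξ n) fun x => ?_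
    have hlip : LipschitzWith (C * ‖cmb (fun i : Fin n => ξ i)‖₊)
        (fun v : Fin n → ℝ => g (x + cmb (fun i : Fin n => ξ i) v)) := by
      refine hg.comp ?_
      simpa using (LipschitzWith.const x).add (cmb (fun i : Fin n => ξ i)).lipschitz
    have hae := hlip.ae_differentiableAt_of_real (μ := volume)
    rw [ae_iff] at hae
    convert hae using 3
    ext v
    simp only [mem_ofPred_eq]
    rw [not_iff_not]
    have := differentiableAt_comp_add_left (𝕜 := ℝ) (x := (0 : Fin n → ℝ))
      (f := fun v : Fin n → ℝ => g (x + cmb (fun i : Fin n => ξ i) v)) v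
    rw [add_zero] at this
    rw [← this]
    simp [GDn, add_assoc]

lemma lip_major {X : Type*} [NormedAddCommGroup X] (f : X → ℝ) (A B : Set X)
    (hAB : A ⊆ B) (k : NNReal) (h : ∀ a ∈ A, ∀ y ∈ B, f y ≤ f a + k * ‖y - a‖) :
    ∃ g : X → ℝ, LipschitzWith k g ∧ (A.Nonempty → ∀ y ∈ B, f y ≤ g y) ∧ ∀ a ∈ A, g a = f a := by
  rcases A.eq_empty_or_nonempty with rfl | ⟨a0, ha0⟩
  · exact ⟨fun _ => 0, LipschitzWith.const' _, by simp, by simp⟩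
  have : Nonempty A := ⟨⟨a0, ha0⟩⟩
  have hbdd : ∀ y, BddBelow (range fun a : A => f a + k * ‖y - (a : X)‖) := by
    intro y
    refine ⟨f a0 - k * ‖y - a0‖, ?_⟩
    rintro _ ⟨a, rfl⟩
    have h1 := h a a.2 a0 (hAB ha0)
    have h2 : ‖a0 - a‖ ≤ ‖y - a0‖ + ‖y - a‖ := by
      have : a0 - (a : X) = (y - a) - (y - a0) := by abel
      rw [this]
      linarith [norm_sub_le (y - (a : X)) (y - a0)]
    have h3 := mul_le_mul_of_nonneg_left h2 k.2
    simp only [NNReal.val_eq_coe] at h3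
    dsimp only
    linarith
  have hmaj : ∀ y ∈ B, f y ≤ ⨅ a : A, (f a + k * ‖y - (a : X)‖) := fun y hy =>
    le_ciInf fun a => h a a.2 y hy
  refine ⟨fun y : X => ⨅ a : A, (f a + k * ‖y - (a : X)‖), ?_, fun _ => hmaj, ?_⟩
  · refine LipschitzWith.of_le_add_mul _ fun x y => ?_
    rw [← sub_le_iff_le_add]
    refine le_ciInf fun a => ?_
    rw [sub_le_iff_le_add]
    refine (ciInf_le (hbdd x) a).trans ?_
    have h2 : ‖x - a‖ ≤ ‖y - a‖ + dist x y := by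
      rw [dist_eq_norm]
      have : x - (a : X) = (y - a) + (x - y) := by abel
      rw [this]
      exact norm_add_le _ _
    have h3 := mul_le_mul_of_nonneg_left h2 k.2
    simp only [NNReal.val_eq_coe] at h3
    linarith
  · intro a ha
    apply le_antisymm
    · refine (ciInf_le (hbdd a) ⟨a, ha⟩).trans ?_
      simp
    · exact hmaj a (hAB ha)

lemma hadamard_sandwich {X : Type*} [NormedAddCommGroup X] [NormedSpace ℝ X] {f g1 g2 : X → ℝ}
    {x : X} {U : Set X} (hU : U ∈ 𝓝 x) (h1 : ∀ y ∈ U, g1 y ≤ f y) (h2 : ∀ y ∈ U, f y ≤ g2 y)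
    (e1 : g1 x = f x) (e2 : g2 x = f x) (d1 : HadamardDiffAt g1 x) (d2 : HadamardDiffAt g2 x) :
    HadamardDiffAt f x := by
  obtain ⟨L1, hL1⟩ := d1
  obtain ⟨L2, hL2⟩ := d2
  have hev : ∀ (h : X) (t : ℕ → ℝ), Tendsto t atTop (𝓝 0) → ∀ hs : ℕ → X,
      Tendsto hs atTop (𝓝 h) → ∀ᶠ n in atTop, x + t n • hs n ∈ U := by
    intro h t ht hs hh
    have : Tendsto (fun n => x + t n • hs n) atTop (𝓝 (x + (0:ℝ) • h)) :=
      tendsto_const_nhds.add (ht.smul hh)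
    rw [zero_smul, add_zero] at this
    exact this hU
  have hle : ∀ h, L1 h ≤ L2 h := by
    intro h
    have ht : Tendsto (fun n : ℕ => 1 / ((n : ℝ) + 1)) atTop (𝓝 0) :=
      tendsto_one_div_add_atTop_nhds_zero_nat
    have hp : ∀ n : ℕ, 0 < 1 / ((n : ℝ) + 1) := fun n => by positivity
    refine le_of_tendsto_of_tendsto
      (hL1 h _ (fun n => (hp n).ne') ht (fun _ => h) tendsto_const_nhds)
      (hL2 h _ (fun n => (hp n).ne') ht (fun _ => h) tendsto_const_nhds) ?_
    filter_upwards [hev h _ ht (fun _ => h) tendsto_const_nhds] with n hn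
    rw [e1, e2]
    refine div_le_div_of_nonneg_right ?_ (hp n).le
    linarith [h1 _ hn, h2 _ hn]
  have heq : ∀ h, L1 h = L2 h := by
    intro h
    refine le_antisymm (hle h) ?_
    have := hle (-h)
    simp only [map_neg] at this
    linarith
  refine ⟨L1, fun h t ht0 ht hs hh => ?_⟩
  have t1 := hL1 h t ht0 ht hs hh
  have t2 := hL2 h t ht0 ht hs hh
  rw [← heq] at t2
  have t3 := (t2.sub t1).abs
  rw [sub_self, abs_zero] at t3
  have t4 : Tendsto (fun n => (f (x + t n • hs n) - f x) / t n - (g1 (x + t n • hs n) - g1 x) / t n)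
      atTop (𝓝 0) := by
    refine squeeze_zero_norm' ?_ t3
    filter_upwards [hev h t ht hs hh] with n hn
    rw [Real.norm_eq_abs, ← sub_div, ← sub_div, abs_div, abs_div]
    refine div_le_div_of_nonneg_right ?_ (abs_nonneg _)
    have a1 := h1 _ hn
    have a2 := h2 _ hn
    rw [abs_of_nonneg (by linarith), abs_of_nonneg (by linarith)]
    linarith
  simpa using t4.add t1

/-- Stepanov, following Maly. -/
lemma stepanov {X : Type*} [NormedAddCommGroup X] [NormedSpace ℝ X]
    [SecondCountableTopology X] [MeasurableSpace X] [BorelSpace X] (f : X → ℝ) :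
    ∃ N : Set X, AronszajnNull N ∧ ∀ x ∉ N,
      (∃ k : ℕ, ∀ y, ‖y - x‖ < 1 / ((k : ℝ) + 1) → |f y - f x| ≤ k * ‖y - x‖) →
        HadamardDiffAt f x := by
  let A : Set X → ℕ → Set X := fun U k => {x ∈ U | ∀ y ∈ U, |f y - f x| ≤ k * ‖y - x‖}
  have hA : ∀ U k, A U k ⊆ U := fun U k x hx => hx.1
  have hmaj := fun U (k : ℕ) => lip_major f (A U k) U (hA U k) k (fun a ha y hy => by
    have := (abs_le.1 (ha.2 y hy)).2
    simp only [NNReal.coe_natCast]; linarith)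
  have hmin := fun U (k : ℕ) => lip_major (fun x => - f x) (A U k) U (hA U k) k (fun a ha y hy => by
    have := (abs_le.1 (ha.2 y hy)).1
    simp only [NNReal.coe_natCast]; linarith)
  choose g2 l2 m2 q2 using hmaj
  choose g1 l1 m1 q1 using hmin
  have l1' : ∀ U (k : ℕ), LipschitzWith (k : NNReal) (fun x => - g1 U k x) := fun U k => (l1 U k).neg
  choose N2 n2 D2 using fun U k => lipschitz_aronszajn (l2 U k)
  choose N1 n1 D1 using fun U k => lipschitz_aronszajn (l1' U k)
  have := (TopologicalSpace.countable_countableBasis X).to_subtype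
  refine ⟨⋃ p : TopologicalSpace.countableBasis X × ℕ, (N1 p.1 p.2 ∪ N2 p.1 p.2),
    AronszajnNull.iUnion' fun p => (n1 _ _).union' (n2 _ _), ?_⟩
  rintro x hx ⟨k, hk⟩
  obtain ⟨U, hU, hxU, hUb⟩ := (TopologicalSpace.isBasis_countableBasis X).mem_nhds_iff.1
    (Metric.ball_mem_nhds x (ε := 1 / ((k : ℝ) + 1)) (by positivity))
  have hxA : x ∈ A U k := ⟨hxU, fun y hy => hk y (by simpa [dist_eq_norm] using hUb hy)⟩
  simp only [mem_iUnion, not_exists, mem_union, not_or] at hx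
  have hx' := hx (⟨U, hU⟩, k)
  refine hadamard_sandwich
    (((TopologicalSpace.isBasis_countableBasis X).isOpen hU).mem_nhds hxU)
    (g1 := fun x => - g1 U k x) (g2 := g2 U k) (fun y hy => ?_) (m2 U k ⟨x, hxA⟩) ?_
    (q2 U k x hxA) (D1 U k x hx'.1) (D2 U k x hx'.2)
  · have := m1 U k ⟨x, hxA⟩ y hy
    linarith
  · have := q1 U k x hxA
    linarith

lemma QuasiconvexFun.convex_lt {X : Type*} [NormedAddCommGroup X] [NormedSpace ℝ X] {f : X → ℝ}
    (hq : QuasiconvexFun f) (α : ℝ) : Convex ℝ {x | f x < α} := by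
  intro x hx y hy a b ha hb hab
  have := hq x y a ⟨ha, by linarith⟩
  have hb' : 1 - a = b := by linarith
  rw [hb'] at this
  exact this.trans_lt (max_lt hx hy)

/-- the frontier of a convex set with interior is Aronszajn null -/
lemma frontier_null {X : Type*} [NormedAddCommGroup X] [NormedSpace ℝ X]
    [SecondCountableTopology X] [MeasurableSpace X] [BorelSpace X] {K : Set X}
    (hK : Convex ℝ K) (hi : (interior K).Nonempty) : AronszajnNull (frontier K) := by
  refine aronszajn_of_local _ isClosed_frontier.measurableSet fun x0 _ => ?_
  obtain ⟨z, hz⟩ := hi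
  obtain ⟨r, hr, hball⟩ := Metric.isOpen_iff.1 isOpen_interior z hz
  refine ⟨Metric.ball x0 (r / 4), Metric.isOpen_ball, Metric.mem_ball_self (by positivity),
    Metric.ball (x0 - z) (r / 4), Metric.isOpen_ball,
    ⟨_, Metric.mem_ball_self (by positivity)⟩, fun e he y => ?_⟩
  have hsub : {t : ℝ | y + t • e ∈ frontier K ∩ Metric.ball x0 (r / 4)}.Subsingleton := by
    have key : ∀ s t : ℝ, s < t → y + s • e ∈ frontier K ∩ Metric.ball x0 (r / 4) →
        y + t • e ∈ frontier K ∩ Metric.ball x0 (r / 4) → False := by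
      intro s t hst hs ht
      apply hs.1.2
      have hz' : y + s • e - e ∈ interior K := by
        apply hball
        have a1 := hs.2
        rw [mem_ball_iff_norm] at a1 he ⊢
        have : y + s • e - e - z = (y + s • e - x0) - (e - (x0 - z)) := by abel
        rw [this]
        linarith [norm_sub_le (y + s • e - x0) (e - (x0 - z))]
      refine hK.openSegment_interior_closure_subset_interior hz' ht.1.1 ?_
      have hp : 0 < 1 + (t - s) := by linarith
      refine ⟨(t - s) / (1 + (t - s)), 1 / (1 + (t - s)), by have := sub_pos.2 hst; positivity,
        by positivity, by field_simp; ring, ?_⟩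
      have : (t - s) / (1 + (t - s)) = 1 - 1 / (1 + (t - s)) := by field_simp; ring
      rw [this]
      have h3 : (1 / (1 + (t - s))) * (1 + (t - s)) = 1 := by field_simp
      generalize 1 / (1 + (t - s)) = w at h3
      have : (1 - w) • (y + s • e - e) + w • (y + t • e) = y + s • e + (w * (1 + (t - s)) - 1) • e := by
        module
      rw [this, h3]; simp
    intro s hs t ht
    rcases lt_trichotomy s t with h | h | h
    · exact (key s t h hs ht).elim
    · exact h
    · exact (key t s h ht hs).elim
  exact hsub.measure_zero volume

lemma quasi_mono {X : Type*} [NormedAddCommGroup X] [NormedSpace ℝ X] {f : X → ℝ}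
    (hq : QuasiconvexFun f) {α r : ℝ} {z x0 e : X}
    (hz : ∀ u ∈ Metric.ball z r, f u < α) (he : ‖e - (x0 - z)‖ < r / 4) {y w : X} {s : ℝ}
    (hy : ‖y - x0‖ < r / 4) (hfy : α ≤ f y) (hs : 0 < s) (hw : ‖w‖ ≤ s * (r / 4)) :
    f y ≤ f (y + s • e + w) := by
  have hp : 0 < 1 + s := by linarith
  have hz' : f (y - e - s⁻¹ • w) < α := by
    apply hz
    rw [mem_ball_iff_norm]
    have h1 : y - e - s⁻¹ • w - z = (y - x0) - (e - (x0 - z)) - s⁻¹ • w := by abel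
    have h2 : ‖s⁻¹ • w‖ ≤ r / 4 := by
      rw [norm_smul, Real.norm_eq_abs, abs_of_pos (by positivity), inv_mul_le_iff₀ hs]
      exact hw
    rw [h1]
    have h3 := norm_sub_le ((y - x0) - (e - (x0 - z))) (s⁻¹ • w)
    have h4 := norm_sub_le (y - x0) (e - (x0 - z))
    linarith [norm_nonneg (y - x0)]
  have h5 := hq (y + s • e + w) (y - e - s⁻¹ • w) (1 / (1 + s))
    ⟨by positivity, by rw [div_le_one hp]; linarith⟩
  have h6 : (1 / (1 + s)) • (y + s • e + w) + (1 - 1 / (1 + s)) • (y - e - s⁻¹ • w) = y := by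
    match_scalars <;> field_simp <;> ring
  rw [h6] at h5
  rcases le_max_iff.1 h5 with h | h
  · exact h
  · linarith

lemma pointwise_lip {X : Type*} [NormedAddCommGroup X] [NormedSpace ℝ X] {f : X → ℝ}
    (hq : QuasiconvexFun f) {α r : ℝ} (hr : 0 < r) {z x0 e : X}
    (hz : ∀ u ∈ Metric.ball z r, f u < α) (he : ‖e - (x0 - z)‖ < r / 4)
    {U : Set X} (hU : IsOpen U) (hU1 : ∀ u ∈ U, ‖u - x0‖ < r / 4) (hU2 : ∀ u ∈ U, α ≤ f u)
    {y : X} {t : ℝ} (hp : y + t • e ∈ U) (hd : DifferentiableAt ℝ (fun s : ℝ => f (y + s • e)) t) :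
    ∃ k : ℕ, ∀ u, ‖u - (y + t • e)‖ < 1 / ((k : ℝ) + 1) →
      |f u - f (y + t • e)| ≤ k * ‖u - (y + t • e)‖ := by
  obtain ⟨C, hC⟩ := hd.isBigO_sub.bound
  obtain ⟨δ, hδ, hball⟩ := Metric.eventually_nhds_iff.1 hC
  obtain ⟨η, hη, hηU⟩ := Metric.isOpen_iff.1 hU _ hp
  set p := y + t • e with hpdef
  set δ' := min η (min (δ * (r / 4)) (η * (r / 4) / (‖e‖ + 1))) with hδ'
  have hen := norm_nonneg e
  have hδ'pos : 0 < δ' := by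
    refine lt_min hη (lt_min (by positivity) (by positivity))
  obtain ⟨k, hk⟩ := exists_nat_gt (max (1 / δ') (C * (4 / r)))
  have hk1 : 1 / δ' < k := (le_max_left _ _).trans_lt hk
  have hk2 : C * (4 / r) < k := (le_max_right _ _).trans_lt hk
  refine ⟨k, fun u hu => ?_⟩
  have hu' : ‖u - p‖ < δ' := by
    refine hu.trans ?_
    rw [div_lt_comm₀ (by positivity) hδ'pos]
    linarith
  have u1 : ‖u - p‖ < η := hu'.trans_le (min_le_left _ _)
  have u2 : ‖u - p‖ < δ * (r / 4) :=
    hu'.trans_le ((min_le_right _ _).trans (min_le_left _ _))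
  have u3 : ‖u - p‖ < η * (r / 4) / (‖e‖ + 1) :=
    hu'.trans_le ((min_le_right _ _).trans (min_le_right _ _))
  rcases eq_or_ne u p with rfl | hne
  · simp
  have hwpos : 0 < ‖u - p‖ := norm_pos_iff.2 (sub_ne_zero.2 hne)
  set s := ‖u - p‖ * (4 / r) with hs
  have hspos : 0 < s := by positivity
  have hsr : s * (r / 4) = ‖u - p‖ := by rw [hs]; field_simp
  have hsδ : s < δ := by
    rw [← hsr] at u2
    exact lt_of_mul_lt_mul_right u2 (by positivity)
  have hse : s * ‖e‖ < η := by
    rw [lt_div_iff₀ (by positivity), ← hsr] at u3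
    have : s * (‖e‖ + 1) < η := by
      have h4 : (s * (‖e‖ + 1)) * (r / 4) < η * (r / 4) := by linarith
      exact lt_of_mul_lt_mul_right h4 (by positivity)
    linarith
  have huU : u ∈ U := hηU (by rwa [mem_ball_iff_norm])
  have hpU : p - s • e ∈ U := hηU (by
    rw [mem_ball_iff_norm]
    have : p - s • e - p = -(s • e) := by abel
    rw [this, norm_neg, norm_smul, Real.norm_eq_abs, abs_of_pos hspos]
    exact hse)
  have b1 := quasi_mono hq hz he (hU1 u huU) (hU2 u huU) hspos (w := -(u - p))
    (by rw [norm_neg, hsr])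
  have b2 := quasi_mono hq hz he (hU1 _ hpU) (hU2 _ hpU) hspos (w := u - p) (by rw [hsr])
  have c1 : u + s • e + -(u - p) = y + (t + s) • e := by rw [hpdef]; module
  have c2 : p - s • e + s • e + (u - p) = u := by abel
  have c3 : p - s • e = y + (t - s) • e := by rw [hpdef]; module
  rw [c1] at b1
  rw [c2, c3] at b2
  have d1 := @hball (t + s) (by rw [Real.dist_eq]; simpa [abs_of_pos hspos] using hsδ)
  have d2 := @hball (t - s) (by rw [Real.dist_eq]; simpa [abs_of_pos hspos] using hsδ)
  simp only [add_sub_cancel_left, sub_sub_cancel_left, norm_neg, Real.norm_eq_abs,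
    abs_of_pos hspos] at d1 d2
  have hfin : C * s ≤ k * ‖u - p‖ := by
    have : C * s = (C * (4 / r)) * ‖u - p‖ := by rw [hs]; ring
    rw [this]
    gcongr
  rw [abs_le] at d1 d2 ⊢
  constructor <;> linarith [d1.1, d1.2, d2.1, d2.2]

lemma interior_sublevel {X : Type*} [NormedAddCommGroup X] [NormedSpace ℝ X] {f : X → ℝ}
    (hd : DenselyContinuous f) {m : ℝ} (hm : IsTopEssInf f m) {α : ℝ} (hα : m < α) :
    (interior {x | f x < α}).Nonempty := by
  have hres : {x | ContinuousAt f x} ∈ residual X :=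
    residual_of_dense_Gδ (IsGδ.setOfPred_continuousAt f) hd
  by_contra hcon
  apply hm.2 α hα
  rw [IsMeagre]
  refine mem_of_superset hres fun x hx hfx => hcon ⟨x, ?_⟩
  rw [mem_interior_iff_mem_nhds]
  exact hx.eventually_lt continuousAt_const hfx

lemma main_had {X : Type*} [NormedAddCommGroup X] [NormedSpace ℝ X]
    [SecondCountableTopology X] [MeasurableSpace X] [BorelSpace X]
    (f : X → ℝ) (hq : QuasiconvexFun f) (hd : DenselyContinuous f)
    (m : ℝ) (hm : IsTopEssInf f m) :
    ∃ N : Set X, AronszajnNull N ∧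
      ∀ x ∈ {y : X | f y ≤ m}ᶜ \ N, HadamardDiffAt f x := by
  let I := {q : ℚ // m < (q : ℝ)}
  let F : I → Set X := fun q => {x | f x < ((q : ℚ) : ℝ)}
  let G : Set X := ⋃ q, frontier (F q)
  have hint : ∀ q : I, (interior (F q)).Nonempty := fun q => interior_sublevel hd hm q.2
  have hG : AronszajnNull G :=
    AronszajnNull.iUnion' fun q => frontier_null (hq.convex_lt _) (hint q)
  let Ω : Set X := (⋃ q, interior (F q)ᶜ) \ G
  have mΩ : MeasurableSet Ω :=
    (isOpen_iUnion fun q => isOpen_interior).measurableSet.diff hG.1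
  have hsplit : ∀ x ∉ G, ∀ q : I, x ∈ interior (F q) ∨ x ∈ interior (F q)ᶜ := by
    intro x hx q
    by_contra hcon
    push Not at hcon
    apply hx
    refine mem_iUnion.2 ⟨q, ?_⟩
    rw [frontier_eq_closure_inter_closure, closure_compl]
    refine ⟨?_, hcon.1⟩
    have := hcon.2
    rwa [interior_compl, mem_compl_iff, not_not] at this
  have hΩ : ∀ x, m < f x → x ∉ G → x ∈ Ω := by
    intro x hx hxG
    refine ⟨?_, hxG⟩
    obtain ⟨q, hq1, hq2⟩ := exists_rat_btwn hx
    refine mem_iUnion.2 ⟨⟨q, hq1⟩, ?_⟩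
    refine (hsplit x hxG ⟨q, hq1⟩).resolve_left fun h => ?_
    have : f x < q := (interior_subset (s := F _) h :)
    linarith
  have hΩm : ∀ x ∈ Ω, m < f x := by
    intro x hx
    obtain ⟨q, hq1⟩ := mem_iUnion.1 hx.1
    have := interior_subset hq1
    exact q.2.trans_le (not_lt.1 this)
  have hcont : ∀ x ∈ Ω, ContinuousAt f x := by
    intro x hx
    have hxm := hΩm x hx
    rw [ContinuousAt, tendsto_order]
    constructor
    · intro a ha
      obtain ⟨q, hq1, hq2⟩ := exists_rat_btwn (max_lt ha hxm)
      have hqm : m < q := (le_max_right _ _).trans_lt hq1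
      have : x ∈ interior (F ⟨q, hqm⟩)ᶜ := (hsplit x hx.2 ⟨q, hqm⟩).resolve_left fun h => by
        have : f x < q := (interior_subset (s := F _) h :)
        linarith
      filter_upwards [mem_interior_iff_mem_nhds.1 this] with y hy
      have : (q : ℝ) ≤ f y := not_lt.1 hy
      linarith [le_max_left a m]
    · intro a ha
      obtain ⟨q, hq1, hq2⟩ := exists_rat_btwn ha
      have hqm : m < q := hxm.trans hq1
      have : x ∈ interior (F ⟨q, hqm⟩) := (hsplit x hx.2 ⟨q, hqm⟩).resolve_right fun h => by
        exact interior_subset h hq1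
      filter_upwards [mem_interior_iff_mem_nhds.1 this] with y hy
      have : f y < q := hy
      linarith
  let A : ℕ → Set X := fun k => {x ∈ Ω | ∀ y, ‖y - x‖ < 1 / ((k : ℝ) + 1) → |f y - f x| ≤ k * ‖y - x‖}
  have mA : ∀ k, MeasurableSet (A k) := by
    intro k
    have : A k = closure (A k) ∩ Ω := by
      refine Subset.antisymm (fun x hx => ⟨subset_closure hx, hx.1⟩) ?_
      rintro x ⟨hxc, hxΩ⟩
      refine ⟨hxΩ, fun y hy => ?_⟩
      obtain ⟨u, hu, hux⟩ := mem_closure_iff_seq_limit.1 hxc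
      have h1 : Tendsto (fun n => ‖y - u n‖) atTop (𝓝 ‖y - x‖) := (tendsto_const_nhds.sub hux).norm
      have h2 : Tendsto (fun n => |f y - f (u n)|) atTop (𝓝 |f y - f x|) :=
        (tendsto_const_nhds.sub ((hcont x hxΩ).tendsto.comp hux)).abs
      refine le_of_tendsto_of_tendsto h2 (h1.const_mul (k : ℝ)) ?_
      filter_upwards [h1.eventually (gt_mem_nhds hy)] with n hn
      exact (hu n).2 y hn
    rw [this]
    exact isClosed_closure.measurableSet.inter mΩ
  let P : Set X := Ω \ ⋃ k, A k
  have mP : MeasurableSet P := mΩ.diff (MeasurableSet.iUnion mA)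
  have hP : AronszajnNull P := by
    refine aronszajn_of_local P mP fun x0 hx0 => ?_
    obtain ⟨q, hq0⟩ := mem_iUnion.1 hx0.1.1
    obtain ⟨z, hz⟩ := hint q
    obtain ⟨r, hr, hball⟩ := Metric.isOpen_iff.1 isOpen_interior z hz
    have hzr : ∀ u ∈ Metric.ball z r, f u < ((q : ℚ) : ℝ) := fun u hu => (interior_subset (s := F q) (hball hu) :)
    have hUo : IsOpen (Metric.ball x0 (r / 4) ∩ interior (F q)ᶜ) :=
      Metric.isOpen_ball.inter isOpen_interior
    refine ⟨Metric.ball x0 (r / 4) ∩ interior (F q)ᶜ, hUo,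
      ⟨Metric.mem_ball_self (by positivity), hq0⟩,
      Metric.ball (x0 - z) (r / 4), Metric.isOpen_ball,
      ⟨_, Metric.mem_ball_self (by positivity)⟩, fun e he y => ?_⟩
    set U := Metric.ball x0 (r / 4) ∩ interior (F q)ᶜ with hU
    have hU1 : ∀ u ∈ U, ‖u - x0‖ < r / 4 := fun u hu => mem_ball_iff_norm.1 hu.1
    have hU2 : ∀ u ∈ U, ((q : ℚ) : ℝ) ≤ f u := fun u hu => not_lt.1 (interior_subset hu.2)
    rw [mem_ball_iff_norm] at he
    let s : Set ℝ := {t | y + t • e ∈ U}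
    have hso : IsOpen s := hUo.preimage (by fun_prop : Continuous fun t : ℝ => y + t • e)
    have hmono : MonotoneOn (fun t : ℝ => f (y + t • e)) s := by
      intro t ht t' _ htt
      rcases htt.eq_or_lt with rfl | hlt
      · exact le_rfl
      have := quasi_mono hq hzr he (hU1 _ ht) (hU2 _ ht) (sub_pos.2 hlt) (w := 0)
        (by have := sub_pos.2 hlt; simp only [norm_zero]; positivity)
      have e1 : y + t • e + (t' - t) • e + 0 = y + t' • e := by module
      rwa [e1] at this
    have hae := hmono.ae_differentiableWithinAt_of_mem
    rw [ae_iff] at hae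
    refine measure_mono_null ?_ hae
    intro t ht hcon
    have hts : t ∈ s := ht.2
    have hdiff := (hcon hts).differentiableAt (hso.mem_nhds hts)
    obtain ⟨k, hk⟩ := pointwise_lip hq hr hzr he hUo hU1 hU2 hts hdiff
    exact ht.1.2 (mem_iUnion.2 ⟨k, ht.1.1, hk⟩)
  obtain ⟨N, hN, hNd⟩ := stepanov f
  refine ⟨G ∪ P ∪ N, (hG.union' hP).union' hN, ?_⟩
  rintro x ⟨hx, hxN⟩
  simp only [mem_union, not_or] at hxN
  have hxm : m < f x := not_le.1 hx
  have hxΩ := hΩ x hxm hxN.1.1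
  have hxA : x ∈ ⋃ k, A k := by
    by_contra h
    exact hxN.1.2 ⟨hxΩ, h⟩
  obtain ⟨k, hk⟩ := mem_iUnion.1 hxA
  exact hNd x hxN.2 ⟨k, hk.2⟩

end HadAux

/-- On a separable Banach space, a densely continuous quasiconvex function is Hadamard
differentiable on `X \ {f ≤ m}` except at the points of an Aronszajn null set. -/
theorem stmt_9 {X : Type*} [NormedAddCommGroup X] [NormedSpace ℝ X] [CompleteSpace X]
    [TopologicalSpace.SeparableSpace X] [MeasurableSpace X] [BorelSpace X]
    (f : X → ℝ) (hq : QuasiconvexFun f) (hd : DenselyContinuous f)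
    (m : ℝ) (hm : IsTopEssInf f m) :
    ∃ N : Set X, AronszajnNull N ∧
      ∀ x ∈ {y : X | f y ≤ m}ᶜ \ N, HadamardDiffAt f x := by
  have := UniformSpace.secondCountable_of_separable X
  exact main_had f hq hd m hm
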